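/- arXiv:1810.02507 — 3 statements merged into one kernel-verified Lean document; each statement's English description precedes it below -/
import Mathlib

section
/- Let H be a subgroup of SL₂(𝔽₅) that acts transitively on the set of nonzero vectors of 𝔽₅² (under matrix-vector multiplication). Then either H = SL₂(𝔽₅) or H is isomorphic to SL₂(𝔽₃). -/
namespace SL25

abbrev G := Matrix.SpecialLinearGroup (Fin 2) (ZMod 5)
abbrev K := Matrix.SpecialLinearGroup (Fin 2) (ZMod 3)

/-- Lift from `𝔽₃` to `𝔽₅` through the representatives `-1, 0, 1`. -/
def l (t : ZMod 3) : ZMod 5 := if t = 0 then 0 else if t = 1 then 1 else -1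

/-- Scaling factor: `-1/2` for the non-quaternion Hurwitz units. -/
def sc (a b c d : ZMod 3) : ZMod 5 :=
  if a + d = 0 ∨ b - c = 0 ∨ a + b + c - d = 0 ∨ b + c + d - a = 0 then 1 else 2

def p (a b c d : ZMod 3) : ZMod 5 := sc a b c d * (l (-(a + d)) + 2 * l (b - c))
def q (a b c d : ZMod 3) : ZMod 5 :=
  sc a b c d * (-l (a + b + c - d) + 3 * l (b + c + d - a))
def r (a b c d : ZMod 3) : ZMod 5 :=
  sc a b c d * (l (a + b + c - d) + 3 * l (b + c + d - a))
def s (a b c d : ZMod 3) : ZMod 5 := sc a b c d * (l (-(a + d)) + 3 * l (b - c))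

theorem fdet : ∀ a b c d : ZMod 3, a * d - b * c = 1 →
    p a b c d * s a b c d - q a b c d * r a b c d = 1 := by decide +kernel

theorem fone : p 1 0 0 1 = 1 ∧ q 1 0 0 1 = 0 ∧ r 1 0 0 1 = 0 ∧ s 1 0 0 1 = 1 := by
  decide +kernel

theorem fmul : ∀ a b c d : ZMod 3, a * d - b * c = 1 →
    ∀ e f g h : ZMod 3, e * h - f * g = 1 →
    p (a*e+b*g) (a*f+b*h) (c*e+d*g) (c*f+d*h) =
      p a b c d * p e f g h + q a b c d * r e f g h ∧
    q (a*e+b*g) (a*f+b*h) (c*e+d*g) (c*f+d*h) =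
      p a b c d * q e f g h + q a b c d * s e f g h ∧
    r (a*e+b*g) (a*f+b*h) (c*e+d*g) (c*f+d*h) =
      r a b c d * p e f g h + s a b c d * r e f g h ∧
    s (a*e+b*g) (a*f+b*h) (c*e+d*g) (c*f+d*h) =
      r a b c d * q e f g h + s a b c d * s e f g h := by decide +kernel

theorem finj : ∀ a b c d : ZMod 3, a * d - b * c = 1 →
    p a b c d = 1 → q a b c d = 0 → r a b c d = 0 → s a b c d = 1 →
    a = 1 ∧ b = 0 ∧ c = 0 ∧ d = 1 := by decide +kernel

theorem fsurj : ∀ x y : ZMod 5, (x ≠ 0 ∨ y ≠ 0) → ∃ a b c d : ZMod 3,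
    a * d - b * c = 1 ∧ p a b c d = x ∧ r a b c d = y := by decide +kernel

theorem kdet (A : K) : A.1 0 0 * A.1 1 1 - A.1 0 1 * A.1 1 0 = 1 := by
  rw [← Matrix.det_fin_two]; exact A.2

theorem gdet (A : G) : A.1 0 0 * A.1 1 1 - A.1 0 1 * A.1 1 0 = 1 := by
  rw [← Matrix.det_fin_two]; exact A.2

def mk (a b c d : ZMod 5) (h : a * d - b * c = 1) : G :=
  ⟨!![a, b; c, d], by rw [Matrix.det_fin_two_of]; exact h⟩

theorem coe_mk (a b c d h) : (mk a b c d h).1 = !![a, b; c, d] := rfl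

theorem gext (A B : G) (h1 : A.1 0 0 = B.1 0 0) (h2 : A.1 0 1 = B.1 0 1)
    (h3 : A.1 1 0 = B.1 1 0) (h4 : A.1 1 1 = B.1 1 1) : A = B := by
  apply Subtype.ext
  ext i j
  fin_cases i <;> fin_cases j <;> assumption

theorem mk_mul (a b c d e f g h : ZMod 5) (h1 h2) : mk a b c d h1 * mk e f g h h2 =
    mk (a*e+b*g) (a*f+b*h) (c*e+d*g) (c*f+d*h) (by linear_combination (e*h-f*g) * h1 + h2) := by
  apply gext <;> simp [coe_mk, Matrix.mul_apply, Fin.sum_univ_two]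

theorem exists_mk (A : G) : ∃ a b c d h, A = mk a b c d h :=
  ⟨_, _, _, _, gdet A, by apply gext <;> simp [mk]⟩

def f : K →* G where
  toFun A := mk _ _ _ _ (fdet _ _ _ _ (kdet A))
  map_one' := by
    obtain ⟨h1, h2, h3, h4⟩ := fone
    apply gext <;> simp [mk, *]
  map_mul' A B := by
    obtain ⟨h1, h2, h3, h4⟩ := fmul _ _ _ _ (kdet A) _ _ _ _ (kdet B)
    rw [mk_mul]
    apply gext <;> simp [mk, Matrix.mul_apply, Fin.sum_univ_two, *]

theorem f_apply (A : K) : f A = mk _ _ _ _ (fdet _ _ _ _ (kdet A)) := rfl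

theorem f_inj : Function.Injective f := by
  rw [injective_iff_map_eq_one]
  intro A h
  have h' : ∀ i j, (f A).1 i j = (1 : G).1 i j := by rw [h]; simp
  obtain ⟨h1, h2, h3, h4⟩ := finj _ _ _ _ (kdet A)
    (by simpa [f_apply, coe_mk] using h' 0 0) (by simpa [f_apply, coe_mk] using h' 0 1)
    (by simpa [f_apply, coe_mk] using h' 1 0) (by simpa [f_apply, coe_mk] using h' 1 1)
  apply Subtype.ext
  ext i j
  fin_cases i <;> fin_cases j <;> simpa

def gi : G := mk 2 0 0 3 (by decide)
def gj : G := mk 0 (-1) 1 0 (by decide)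
def gw : G := mk 1 2 1 3 (by decide)

/-- products `i^m j^n w^k` as entries -/
theorem fgen : ∀ a b c d : ZMod 3, a * d - b * c = 1 →
    ∃ m : Fin 4, ∃ n : Fin 2, ∃ k : Fin 3,
    !![p a b c d, q a b c d; r a b c d, s a b c d] =
      (!![2,0;0,3])^m.1 * (!![0,-1;1,0])^n.1 * (!![1,2;1,3])^k.1 := by
  decide +kernel

theorem f_gen (A : K) : ∃ m n k : ℕ, f A = gi ^ m * gj ^ n * gw ^ k := by
  obtain ⟨m, n, k, h⟩ := fgen _ _ _ _ (kdet A)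
  refine ⟨m, n, k, Subtype.ext ?_⟩
  simpa [f_apply, coe_mk, gi, gj, gw] using h

def Trans (H : Subgroup G) : Prop := ∀ u v : Fin 2 → ZMod 5, u ≠ 0 → v ≠ 0 →
      ∃ h ∈ H, Matrix.mulVec (h : Matrix (Fin 2) (Fin 2) (ZMod 5)) u = v

theorem mulVec_mk (a b c d h x y) : Matrix.mulVec (mk a b c d h).1 ![x, y] =
    ![a*x+b*y, c*x+d*y] := by
  ext i; fin_cases i <;> simp [mk, Matrix.mulVec, dotProduct, Fin.sum_univ_two]

theorem e1_ne : (![1, 0] : Fin 2 → ZMod 5) ≠ 0 := by decide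

theorem inv_mulVec (g : G) (u v : Fin 2 → ZMod 5) (h : Matrix.mulVec g.1 u = v) :
    Matrix.mulVec (g⁻¹).1 v = u := by
  rw [← h, Matrix.mulVec_mulVec, ← Matrix.SpecialLinearGroup.coe_mul, inv_mul_cancel]
  simp

theorem mul_mulVec (g h : G) (u : Fin 2 → ZMod 5) :
    Matrix.mulVec (g * h).1 u = Matrix.mulVec g.1 (Matrix.mulVec h.1 u) := by
  rw [Matrix.mulVec_mulVec, Matrix.SpecialLinearGroup.coe_mul]

theorem fix_e1 (g : G) (h : Matrix.mulVec g.1 ![1, 0] = ![1, 0]) :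
    ∃ x, g = mk 1 x 0 1 (by ring) := by
  obtain ⟨a, b, c, d, hd, rfl⟩ := exists_mk g
  rw [mulVec_mk] at h
  have h0 := congrFun h 0
  have h1 := congrFun h 1
  simp at h0 h1
  subst h0 h1
  have : d = 1 := by simpa using hd
  subst this
  exact ⟨b, rfl⟩

theorem upow (x : ZMod 5) (n : ℕ) :
    (mk 1 x 0 1 (by ring)) ^ n = mk 1 (n * x) 0 1 (by ring) := by
  induction n with
  | zero => rw [pow_zero]; apply gext <;> simp [mk]
  | succ n ih => rw [pow_succ, ih, mk_mul]; apply gext <;> simp [mk]; ring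

theorem top_of_unip (H : Subgroup G) (hH : Trans H) (g : G) (hg : g ∈ H)
    (v : Fin 2 → ZMod 5) (hv : v ≠ 0) (hgv : Matrix.mulVec g.1 v = v) (hne : g ≠ 1) :
    H = ⊤ := by
  obtain ⟨h, hh, hhv⟩ := hH v ![1, 0] hv e1_ne
  have hf : Matrix.mulVec (h * g * h⁻¹).1 ![1, 0] = ![1, 0] := by
    rw [mul_mulVec, mul_mulVec, inv_mulVec _ _ _ hhv, hgv, hhv]
  obtain ⟨x, hx⟩ := fix_e1 _ hf
  have hm : h * g * h⁻¹ ∈ H := H.mul_mem (H.mul_mem hh hg) (H.inv_mem hh)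
  have hx0 : x ≠ 0 := by
    rintro rfl
    apply hne
    have : h * g * h⁻¹ = 1 := by rw [hx]; apply gext <;> simp [mk]
    simpa using this
  rw [hx] at hm
  have hU : ∀ y, mk 1 y 0 1 (by ring) ∈ H := by
    intro y
    have : ∀ x y : ZMod 5, x ≠ 0 → ∃ n : Fin 5, (n.1 : ZMod 5) * x = y := by decide +kernel
    obtain ⟨n, hn⟩ := this x y hx0
    have := H.pow_mem hm n.1
    rw [upow] at this
    simpa only [hn] using this
  rw [eq_top_iff]
  intro k _
  have hk0 : Matrix.mulVec k.1 ![1, 0] ≠ 0 := by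
    intro h0
    have := inv_mulVec _ _ _ h0
    simp at this
    exact e1_ne this.symm
  obtain ⟨m, hm, hmv⟩ := hH _ _ e1_ne hk0
  obtain ⟨y, hy⟩ := fix_e1 (m⁻¹ * k) (by rw [mul_mulVec, inv_mulVec _ _ _ hmv])
  have := H.mul_mem hm (hU y)
  rw [← hy] at this
  simpa using this

def NoUnip (H : Subgroup G) : Prop :=
  ∀ g ∈ H, ∀ v : Fin 2 → ZMod 5, v ≠ 0 → Matrix.mulVec g.1 v = v → g = 1

set_option synthInstance.maxHeartbeats 400000 in
set_option synthInstance.maxSize 4000 in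
theorem tr_aux : ∀ a b c d : ZMod 5, a * d - b * c = 1 → (a + d = 2 ∨ a + d = -2) →
    ∃ x y : ZMod 5, (x ≠ 0 ∨ y ≠ 0) ∧ (a*a+b*c)*x+(a*b+b*d)*y = x ∧
      (c*a+d*c)*x+(c*b+d*d)*y = y := by decide +kernel

theorem no_tr (H : Subgroup G) (hH : NoUnip H) (a b c d h) (hm : mk a b c d h ∈ H)
    (ht : a + d = 2 ∨ a + d = -2) : c = 0 := by
  obtain ⟨x, y, hxy, h1, h2⟩ := tr_aux a b c d h ht
  have := hH _ (H.mul_mem hm hm) ![x, y] (by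
    intro h0
    have h00 := congrFun h0 0
    have h01 := congrFun h0 1
    simp at h00 h01
    tauto) (by rw [mk_mul, mulVec_mk, h1, h2])
  rw [mk_mul] at this
  have h10 : (mk (a*a+b*c) (a*b+b*d) (c*a+d*c) (c*b+d*d)
    (by linear_combination (a*d-b*c) * h + h)).1 1 0 = (1 : G).1 1 0 := by rw [this]
  simp [mk] at h10
  have h3 : c * (a + d) = 0 := by linear_combination h10
  have hz : ∀ c t : ZMod 5, (t = 2 ∨ t = -2) → c * t = 0 → c = 0 := by decide +kernel
  exact hz c (a + d) ht h3

theorem main_i (H : Subgroup G) (hT : Trans H) (hN : NoUnip H) (hi : gi ∈ H) :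
    H = f.range := by
  have hj : gj ∈ H := by
    obtain ⟨g, hg, hgv⟩ := hT ![1, 0] ![0, 1] e1_ne (by decide)
    obtain ⟨a, b, c, d, hd, rfl⟩ := exists_mk g
    rw [mulVec_mk] at hgv
    have h0 := congrFun hgv 0
    have h1 := congrFun hgv 1
    simp at h0 h1
    subst h0 h1
    have hb : b = -1 := by linear_combination -hd
    subst hb
    have t1 := no_tr H hN _ _ _ _ _ hg
    have hg2 := H.mul_mem hi hg
    rw [gi, mk_mul] at hg2
    have t2 := no_tr H hN _ _ _ _ _ hg2
    have : d = 0 := by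
      clear hg2 hg hgv hd
      revert t1 t2
      revert d
      decide
    subst this
    exact hg
  have hw : gw ∈ H := by
    obtain ⟨g, hg, hgv⟩ := hT ![1, 0] ![1, 1] e1_ne (by decide)
    obtain ⟨a, b, c, d, hd, rfl⟩ := exists_mk g
    rw [mulVec_mk] at hgv
    have h0 := congrFun hgv 0
    have h1 := congrFun hgv 1
    simp at h0 h1
    subst h0 h1
    have hb : d = 1 + b := by linear_combination hd
    subst hb
    have t1 := no_tr H hN _ _ _ _ _ hg
    have hg2 := H.mul_mem hi hg
    rw [gi, mk_mul] at hg2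
    have t2 := no_tr H hN _ _ _ _ _ hg2
    have hg3 := H.mul_mem hj hg
    rw [gj, mk_mul] at hg3
    have t3 := no_tr H hN _ _ _ _ _ hg3
    have : b = 2 := by
      clear hg2 hg hgv hd hg3
      revert t1 t2 t3
      revert b
      decide
    subst this
    exact hg
  have hle : ∀ A, f A ∈ H := by
    intro A
    obtain ⟨m, n, k, h⟩ := f_gen A
    rw [h]
    exact H.mul_mem (H.mul_mem (H.pow_mem hi _) (H.pow_mem hj _)) (H.pow_mem hw _)
  apply le_antisymm
  · intro g hg
    obtain ⟨x, y, z, w, hd, rfl⟩ := exists_mk g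
    obtain ⟨a, b, c, d, h, h1, h2⟩ := fsurj x z (by
      by_contra hc
      push Not at hc
      rw [hc.1, hc.2] at hd
      simp only [zero_mul, mul_zero, sub_zero] at hd
      exact absurd hd (by decide))
    let A : K := ⟨!![a, b; c, d], by rw [Matrix.det_fin_two_of]; exact h⟩
    have hA : Matrix.mulVec (f A).1 ![1, 0] = ![x, z] := by
      have : f A = mk _ _ _ _ (fdet _ _ _ _ h) := rfl
      rw [this, mulVec_mk, h1, h2]; simp
    have := hN _ (H.mul_mem (H.inv_mem (hle A)) hg) ![1, 0] e1_ne (by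
      rw [mul_mulVec, mulVec_mk]
      apply inv_mulVec
      rw [hA]; simp)
    exact ⟨A, (inv_mul_eq_one.1 this)⟩
  · rintro _ ⟨A, rfl⟩
    exact hle A

end SL25

/-- a subgroup `H ≤ SL₂(𝔽₅)` acting transitively on the nonzero vectors of `𝔽₅²`
is either all of `SL₂(𝔽₅)` or isomorphic to `SL₂(𝔽₃)`. -/
theorem transitive_subgroup_sl2_five
    (H : Subgroup (Matrix.SpecialLinearGroup (Fin 2) (ZMod 5)))
    (htrans : ∀ u v : Fin 2 → ZMod 5, u ≠ 0 → v ≠ 0 →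
      ∃ h ∈ H, Matrix.mulVec (h : Matrix (Fin 2) (Fin 2) (ZMod 5)) u = v) :
    H = ⊤ ∨ Nonempty (H ≃* Matrix.SpecialLinearGroup (Fin 2) (ZMod 3)) := by
  by_cases hN : SL25.NoUnip H
  swap
  · left
    unfold SL25.NoUnip at hN
    push Not at hN
    obtain ⟨g, hg, v, hv, hgv, hne⟩ := hN
    exact SL25.top_of_unip H htrans g hg v hv hgv hne
  right
  obtain ⟨g, hg, hgv⟩ := htrans ![1, 0] ![2, 0] SL25.e1_ne (by decide)
  obtain ⟨a, b, c, d, hd, rfl⟩ := SL25.exists_mk g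
  rw [SL25.mulVec_mk] at hgv
  have h0 := congrFun hgv 0
  have h1 := congrFun hgv 1
  simp at h0 h1
  subst h0 h1
  have hd3 : d = 3 := by
    clear hg hgv
    revert hd
    revert b d
    decide
  subst hd3
  let u : SL25.G := SL25.mk 1 (-b) 0 1 (by ring)
  let e := MulAut.conj u
  have hu : e (SL25.mk 2 b 0 3 hd) = SL25.gi := by
    rw [MulAut.conj_apply, mul_inv_eq_iff_eq_mul]
    simp only [u, SL25.gi, SL25.mk_mul]
    apply SL25.gext <;> simp [SL25.mk]
    ring
  have hT' : SL25.Trans (H.map e.toMonoidHom) := by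
    intro x y hx hy
    have nz : ∀ x : Fin 2 → ZMod 5, x ≠ 0 → Matrix.mulVec (u⁻¹).1 x ≠ 0 := by
      intro x hx h
      have := SL25.inv_mulVec _ _ _ h
      simp at this
      exact hx this.symm
    obtain ⟨h, hh, hxy⟩ := htrans _ _ (nz x hx) (nz y hy)
    refine ⟨e h, ⟨h, hh, rfl⟩, ?_⟩
    rw [MulAut.conj_apply, SL25.mul_mulVec, SL25.mul_mulVec, hxy, ← SL25.mul_mulVec]
    simp
  have hN' : SL25.NoUnip (H.map e.toMonoidHom) := by
    rintro _ ⟨h, hh, rfl⟩ v hv hfix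
    have hfix' : Matrix.mulVec (u * h * u⁻¹).1 v = v := hfix
    rw [SL25.mul_mulVec, SL25.mul_mulVec] at hfix'
    have h2 := SL25.inv_mulVec _ _ _ hfix'
    have := hN h hh (Matrix.mulVec (u⁻¹).1 v) (by
      intro h0
      rw [h0] at hfix'
      simp at hfix'
      exact hv hfix'.symm) h2.symm
    rw [this]; simp
  have key := SL25.main_i _ hT' hN' ⟨_, hg, hu⟩
  exact ⟨((H.equivMapOfInjective e.toMonoidHom e.injective).trans
    (MulEquiv.subgroupCongr key)).trans (MonoidHom.ofInjective SL25.f_inj).symm⟩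
end

section
/- Let H be a subgroup of SL₂(𝔽₇) that acts transitively on the set of nonzero vectors of 𝔽₇² (under matrix-vector multiplication). Then either H = SL₂(𝔽₇), or H has order 48 and contains a normal subgroup of index 2 isomorphic to SL₂(𝔽₃). -/
/-- Matrices over the field with seven elements. -/
abbrev Mat7 := Matrix (Fin 2) (Fin 2) (ZMod 7)

/-- Explicit embedding of `SL₂(𝔽₃)` into `SL₂(𝔽₇)`, on matrix entries. -/
def embAux (a b c d : Fin 3) : Mat7 :=
  match a, b, c, d with
  | 0, 1, 2, 0 => !![0, 5; 4, 0]
  | 0, 1, 2, 1 => !![5, 0; 3, 3]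
  | 0, 1, 2, 2 => !![2, 2; 0, 4]
  | 0, 2, 1, 0 => !![0, 2; 3, 0]
  | 0, 2, 1, 1 => !![5, 5; 0, 3]
  | 0, 2, 1, 2 => !![2, 0; 4, 4]
  | 1, 0, 0, 1 => !![1, 0; 0, 1]
  | 1, 0, 1, 1 => !![0, 3; 2, 6]
  | 1, 0, 2, 1 => !![6, 4; 5, 0]
  | 1, 1, 0, 1 => !![0, 1; 6, 6]
  | 1, 1, 1, 2 => !![4, 4; 1, 3]
  | 1, 1, 2, 0 => !![3, 2; 0, 5]
  | 1, 2, 0, 1 => !![6, 6; 1, 0]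
  | 1, 2, 1, 0 => !![3, 0; 4, 5]
  | 1, 2, 2, 2 => !![5, 1; 2, 2]
  | 2, 0, 0, 2 => !![6, 0; 0, 6]
  | 2, 0, 1, 2 => !![1, 3; 2, 0]
  | 2, 0, 2, 2 => !![0, 4; 5, 1]
  | 2, 1, 0, 2 => !![1, 1; 6, 0]
  | 2, 1, 1, 1 => !![2, 6; 5, 5]
  | 2, 1, 2, 0 => !![4, 0; 3, 2]
  | 2, 2, 0, 2 => !![0, 6; 1, 1]
  | 2, 2, 1, 0 => !![4, 5; 0, 2]
  | 2, 2, 2, 1 => !![3, 3; 6, 4]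
  | _, _, _, _ => 0

/-- `embAux` on `ZMod 3`. -/
def emb (a b c d : ZMod 3) : Mat7 := embAux a b c d

/-- Certificates: either a word with a nonzero fixed vector, or words giving a conjugate of
the generators of the embedded `SL₂(𝔽₃)`. -/
inductive Cert where
  | bad (w : List (Fin 3)) (v : Fin 2 → ZMod 7)
  | good (M M' : Mat7) (wA wB : List (Fin 3))

/-- The certificate for each choice of parameters. -/
def certAux (t x y : Fin 7) : Cert :=
  match t, x, y with
  | 0, 0, 0 => .bad [2] ![0, 1]
  | 0, 0, 1 => .bad [0, 0, 1, 2] ![1, 4]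
  | 0, 0, 2 => .good !![0, 1; 3, 4] !![1, 5; 1, 0] [1, 0, 2, 1] [0, 0, 0, 2]
  | 0, 0, 3 => .bad [0, 2] ![1, 3]
  | 0, 0, 4 => .good !![0, 1; 4, 3] !![1, 2; 1, 0] [2, 0, 1] [2]
  | 0, 0, 5 => .bad [0, 1, 2] ![1, 6]
  | 0, 0, 6 => .bad [0, 0, 0, 2] ![0, 1]
  | 0, 1, _ => .good !![0, 1; 3, 0] !![0, 5; 1, 0] [0, 1, 0] [1, 1]
  | 0, 2, _ => .bad [1] ![1, 5]
  | 0, 3, _ => .good !![1, 1; 4, 6] !![3, 3; 5, 4] [0, 1, 0, 1] [1, 0, 1, 0]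
  | 0, 4, _ => .good !![1, 1; 3, 1] !![3, 4; 5, 3] [0, 1, 0, 1] [1, 0, 1, 0]
  | 0, 5, _ => .bad [1, 1] ![1, 2]
  | 0, 6, _ => .good !![0, 1; 2, 2] !![6, 4; 1, 0] [1] [1, 1, 0]
  | 1, 0, _ => .good !![0, 1; 1, 0] !![0, 1; 1, 0] [0, 0] [1, 0, 1]
  | 1, 1, _ => .bad [0, 1] ![1, 4]
  | 1, 2, _ => .bad [1] ![1, 5]
  | 1, 3, _ => .bad [0, 0, 1, 0, 1, 0, 1, 1] ![1, 6]
  | 1, 4, _ => .bad [0, 1, 0, 1] ![1, 5]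
  | 1, 5, _ => .bad [1, 1] ![1, 2]
  | 1, 6, _ => .good !![0, 1; 5, 0] !![0, 3; 1, 0] [1, 1] [0, 0]
  | 2, 0, _ => .bad [0] ![1, 6]
  | 2, 1, _ => .bad [0] ![1, 6]
  | 2, 2, _ => .bad [0] ![1, 6]
  | 2, 3, _ => .bad [0] ![1, 6]
  | 2, 4, _ => .bad [0] ![1, 6]
  | 2, 5, _ => .bad [0] ![1, 6]
  | 2, 6, _ => .bad [0] ![1, 6]
  | 3, 0, _ => .good !![1, 1; 6, 2] !![3, 2; 5, 5] [1, 0, 1, 1] [0, 1, 1, 1]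
  | 3, 1, _ => .bad [0, 0, 1, 0, 1, 0, 1, 1] ![1, 5]
  | 3, 2, _ => .bad [1] ![1, 5]
  | 3, 3, _ => .bad [0, 0, 1, 0, 1, 1] ![1, 4]
  | 3, 4, _ => .good !![0, 1; 3, 5] !![3, 5; 1, 0] [1, 0] [0, 1]
  | 3, 5, _ => .bad [0, 1] ![1, 5]
  | 3, 6, _ => .bad [0, 0, 1] ![0, 1]
  | 4, 0, _ => .good !![1, 1; 1, 5] !![3, 5; 5, 2] [1, 0, 1, 1] [0, 1, 1, 1]
  | 4, 1, _ => .bad [0, 1, 0, 1] ![1, 6]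
  | 4, 2, _ => .bad [1] ![1, 5]
  | 4, 3, _ => .good !![0, 1; 4, 2] !![3, 2; 1, 0] [1, 0] [0, 1]
  | 4, 4, _ => .bad [0, 0, 1, 0, 1, 1] ![1, 3]
  | 4, 5, _ => .bad [1, 1] ![1, 2]
  | 4, 6, _ => .bad [0, 0, 0, 1, 0, 1, 1] ![1, 5]
  | 5, 0, _ => .bad [0, 0] ![1, 1]
  | 5, 1, _ => .bad [0, 0] ![1, 1]
  | 5, 2, _ => .bad [1] ![1, 5]
  | 5, 3, _ => .bad [0, 0] ![1, 1]
  | 5, 4, _ => .bad [0, 0] ![1, 1]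
  | 5, 5, _ => .bad [0, 0] ![1, 1]
  | 5, 6, _ => .bad [0, 0] ![1, 1]
  | 6, 0, _ => .good !![0, 1; 5, 1] !![4, 3; 1, 0] [0, 0, 1] [0]
  | 6, 1, _ => .good !![0, 1; 2, 0] !![0, 4; 1, 0] [1, 1] [0, 0]
  | 6, 2, _ => .bad [1] ![1, 5]
  | 6, 3, _ => .bad [0, 1, 1] ![1, 0]
  | 6, 4, _ => .bad [0, 0, 1, 0, 1, 1, 1] ![1, 6]
  | 6, 5, _ => .bad [1, 1] ![1, 2]
  | 6, 6, _ => .bad [0, 1] ![1, 3]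

/-- `certAux` on `ZMod 7`. -/
def cert (t x y : ZMod 7) : Cert := certAux t x y

/-- The generators: elements moving `e₁` to `(0,1)`, `(0,2)`, `(1,1)`. -/
def gens (t x y : ZMod 7) : Fin 3 → Mat7 :=
  ![!![0, 6; 1, t], !![0, 3; 2, x], !![1, y; 1, 1 + y]]

/-- Evaluate a word. -/
def wprod (g : Fin 3 → Mat7) : List (Fin 3) → Mat7
  | [] => 1
  | i :: w => g i * wprod g w

/-- Validity of a certificate. -/
def Cert.ok (g : Fin 3 → Mat7) : Cert → Prop
  | .bad w v => v ≠ 0 ∧ (wprod g w).mulVec v = v ∧ wprod g w ≠ 1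
  | .good M M' wA wB => M' * M = 1 ∧ M * emb 1 1 0 1 * M' = wprod g wA ∧
      M * emb 1 0 1 1 * M' = wprod g wB

instance (g : Fin 3 → Mat7) (c : Cert) : Decidable (c.ok g) := by
  cases c <;> unfold Cert.ok <;> infer_instance

theorem cert_ok : ∀ t x y : ZMod 7, (cert t x y).ok (gens t x y) := by
  decide +kernel

theorem emb_mul : ∀ a b c d : ZMod 3, a * d - b * c = 1 → ∀ a' b' c' d' : ZMod 3,
    a' * d' - b' * c' = 1 →
    emb (a * a' + b * c') (a * b' + b * d') (c * a' + d * c') (c * b' + d * d') =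
      emb a b c d * emb a' b' c' d' := by
  decide +kernel

theorem emb_det : ∀ a b c d : ZMod 3, a * d - b * c = 1 →
    emb a b c d 0 0 * emb a b c d 1 1 - emb a b c d 0 1 * emb a b c d 1 0 = 1 := by
  decide +kernel

theorem emb_ker : ∀ a b c d : ZMod 3, a * d - b * c = 1 → emb a b c d = 1 →
    a = 1 ∧ b = 0 ∧ c = 0 ∧ d = 1 := by
  decide +kernel

/-- Every element of `SL₂(𝔽₃)` is a product of elementary matrices. -/
theorem sl3_gen : ∀ a b c d : ZMod 3, a * d - b * c = 1 → ∃ i j k l : Fin 3,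
    (!![a, b; c, d] : Matrix (Fin 2) (Fin 2) (ZMod 3)) =
      !![1, 1; 0, 1] ^ i.1 * !![1, 0; 1, 1] ^ j.1 * !![1, 1; 0, 1] ^ k.1
        * !![1, 0; 1, 1] ^ l.1 := by
  decide +kernel

/-- The special linear groups in play. -/
abbrev SL7 := Matrix.SpecialLinearGroup (Fin 2) (ZMod 7)

abbrev SL3 := Matrix.SpecialLinearGroup (Fin 2) (ZMod 3)

theorem sl3_det (x : SL3) : x.1 0 0 * x.1 1 1 - x.1 0 1 * x.1 1 0 = 1 := by
  have := x.2
  rwa [Matrix.det_fin_two] at this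

/-- The embedding on elements, as a matrix. -/
def embM (x : SL3) : Mat7 := emb (x.1 0 0) (x.1 0 1) (x.1 1 0) (x.1 1 1)

theorem embM_mul (x y : SL3) : embM (x * y) = embM x * embM y := by
  have h := emb_mul _ _ _ _ (sl3_det x) _ _ _ _ (sl3_det y)
  unfold embM
  rw [← h]
  simp [Matrix.mul_apply, Fin.sum_univ_two]

theorem embM_one : embM 1 = 1 := by
  decide +kernel

theorem embM_det (x : SL3) : (embM x).det = 1 := by
  rw [Matrix.det_fin_two]
  exact emb_det _ _ _ _ (sl3_det x)

theorem embM_ker (x : SL3) (h : embM x = 1) : x = 1 := by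
  obtain ⟨h1, h2, h3, h4⟩ := emb_ker _ _ _ _ (sl3_det x) h
  ext i j
  fin_cases i <;> fin_cases j <;> simpa

/-- The conjugated embedding, as a homomorphism. -/
def embHom (M M' : Mat7) (h : M' * M = 1) : SL3 →* SL7 where
  toFun x := ⟨M * embM x * M', by
    have h2 := congrArg Matrix.det h
    rw [Matrix.det_mul, Matrix.det_one] at h2
    rw [Matrix.det_mul, Matrix.det_mul, embM_det, mul_one, mul_comm, h2]⟩
  map_one' := by
    apply Subtype.ext
    change M * embM 1 * M' = 1
    rw [embM_one, mul_one]
    exact mul_eq_one_comm.mp h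
  map_mul' x y := by
    apply Subtype.ext
    change M * embM (x * y) * M' = M * embM x * M' * (M * embM y * M')
    calc M * embM (x * y) * M' = M * embM x * 1 * embM y * M' := by
          rw [embM_mul, mul_one]; simp only [mul_assoc]
      _ = _ := by rw [← h]; simp only [mul_assoc]

theorem embHom_injective (M M' : Mat7) (h : M' * M = 1) :
    Function.Injective (embHom M M' h) := by
  rw [injective_iff_map_eq_one]
  intro x hx
  apply embM_ker
  have h1 : M * embM x * M' = 1 := congrArg Subtype.val hx
  calc embM x = (M' * M) * embM x * (M' * M) := by rw [h]; simp
    _ = M' * (M * embM x * M') * M := by simp only [mul_assoc]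
    _ = 1 := by rw [h1, mul_one, h]

/-- The two generators of `SL₂(𝔽₃)`. -/
def gT : SL3 := ⟨!![1, 1; 0, 1], by decide⟩

def gU : SL3 := ⟨!![1, 0; 1, 1], by decide⟩

theorem embHom_range_le (M M' : Mat7) (h : M' * M = 1) (H : Subgroup SL7)
    (hT : embHom M M' h gT ∈ H) (hU : embHom M M' h gU ∈ H) : (embHom M M' h).range ≤ H := by
  rintro _ ⟨x, rfl⟩
  obtain ⟨i, j, k, l, hx⟩ := sl3_gen _ _ _ _ (sl3_det x)
  have hx' : x = gT ^ i.1 * gU ^ j.1 * gT ^ k.1 * gU ^ l.1 := by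
    apply Subtype.ext
    rw [← Matrix.eta_fin_two x.1] at hx
    exact hx
  rw [hx']
  simp only [map_mul, map_pow]
  exact H.mul_mem (H.mul_mem (H.mul_mem (H.pow_mem hT _) (H.pow_mem hU _)) (H.pow_mem hT _))
    (H.pow_mem hU _)

theorem card_SL3 : Nat.card SL3 = 24 := by
  rw [Nat.card_eq_fintype_card]
  decide +kernel

theorem card_nonzero : Nat.card {v : Fin 2 → ZMod 7 // v ≠ 0} = 48 := by
  rw [Nat.card_eq_fintype_card]
  decide +kernel

theorem wprod_mem (H : Subgroup SL7) (g : Fin 3 → Mat7) (hg : ∀ i, ∃ h ∈ H, h.1 = g i)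
    (w : List (Fin 3)) : ∃ h ∈ H, h.1 = wprod g w := by
  induction w with
  | nil => exact ⟨1, H.one_mem, rfl⟩
  | cons i w ih =>
    obtain ⟨a, ha, ha'⟩ := hg i
    obtain ⟨b, hb, hb'⟩ := ih
    refine ⟨a * b, H.mul_mem ha hb, ?_⟩
    change a.1 * b.1 = g i * wprod g w
    rw [ha', hb']

/-- An element is determined by its first column and one further entry. -/
theorem shape (h : SL7) (v : Fin 2 → ZMod 7) (hv : h.1.mulVec ![1, 0] = v) :
    h.1 0 0 = v 0 ∧ h.1 1 0 = v 1 ∧ v 0 * h.1 1 1 - h.1 0 1 * v 1 = 1 := by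
  have h0 := congrFun hv 0
  have h1 := congrFun hv 1
  have hd := h.2
  rw [Matrix.det_fin_two] at hd
  simp [Matrix.mulVec, dotProduct, Fin.sum_univ_two] at h0 h1
  rw [h0, h1] at hd
  exact ⟨h0, h1, hd⟩

theorem aux1 : ∀ b d : ZMod 7, 0 * d - b * 1 = 1 → b = 6 := by decide
theorem aux2 : ∀ b d : ZMod 7, 0 * d - b * 2 = 1 → b = 3 := by decide
theorem aux3 : ∀ b d : ZMod 7, 1 * d - b * 1 = 1 → d = 1 + b := by decide
theorem aux4 : ∀ b d : ZMod 7, 1 * d - b * 0 = 1 → d = 1 := by decide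
theorem aux5 : ∀ b c : ZMod 7, b ≠ 0 → ∃ k : Fin 7,
  (!![1, b; 0, 1] : Mat7) ^ k.1 = !![1, c; 0, 1] := by decide +kernel

theorem mulVec_mul (a b : SL7) (v : Fin 2 → ZMod 7) :
    (a * b).1.mulVec v = a.1.mulVec (b.1.mulVec v) := by
  change (a.1 * b.1).mulVec v = _
  rw [Matrix.mulVec_mulVec]

theorem mulVec_inv (a : SL7) (v w : Fin 2 → ZMod 7) (h : a.1.mulVec v = w) :
    (a⁻¹).1.mulVec w = v := by
  rw [← h, ← mulVec_mul, inv_mul_cancel]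
  exact Matrix.one_mulVec v

theorem stab_shape (h : SL7) (hv : h.1.mulVec ![1, 0] = ![1, 0]) :
    h.1 = !![1, h.1 0 1; 0, 1] := by
  obtain ⟨h0, h1, h2⟩ := shape h _ hv
  have h3 := aux4 _ _ h2
  rw [Matrix.eta_fin_two h.1, h0, h1, h3]
  rfl

theorem e1_ne : (![1, 0] : Fin 2 → ZMod 7) ≠ 0 := by decide


/-- a subgroup `H ≤ SL₂(𝔽₇)` acting transitively on the nonzero vectors of `𝔽₇²`
is either all of `SL₂(𝔽₇)`, or has order 48 and contains a normal subgroup of index 2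
isomorphic to `SL₂(𝔽₃)`. -/
theorem transitive_subgroup_sl2_seven
    (H : Subgroup (Matrix.SpecialLinearGroup (Fin 2) (ZMod 7)))
    (htrans : ∀ u v : Fin 2 → ZMod 7, u ≠ 0 → v ≠ 0 →
      ∃ h ∈ H, Matrix.mulVec (h : Matrix (Fin 2) (Fin 2) (ZMod 7)) u = v) :
    H = ⊤ ∨ (Nat.card H = 48 ∧ ∃ N : Subgroup H, N.Normal ∧ N.index = 2 ∧
      Nonempty (N ≃* Matrix.SpecialLinearGroup (Fin 2) (ZMod 3))) := by
  by_cases hs : ∀ h ∈ H, h.1.mulVec ![1, 0] = ![1, 0] → h = 1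
  · right
    have hfix : ∀ h ∈ H, ∀ v, v ≠ 0 → h.1.mulVec v = v → h = 1 := by
      intro h hh v hv hhv
      obtain ⟨k, hk, hkv⟩ := htrans ![1, 0] v e1_ne hv
      have h1 := hs (k⁻¹ * h * k) (H.mul_mem (H.mul_mem (H.inv_mem hk) hh) hk) (by
        rw [mulVec_mul, mulVec_mul, hkv, hhv]
        exact mulVec_inv _ _ _ hkv)
      have h2 : h = k * (k⁻¹ * h * k) * k⁻¹ := by group
      rw [h2, h1]
      group
    have hne : ∀ h : SL7, h.1.mulVec ![1, 0] ≠ 0 := by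
      intro h h0
      have := mulVec_inv _ _ _ h0
      rw [Matrix.mulVec_zero] at this
      exact e1_ne this.symm
    have hcard : Nat.card H = 48 := by
      rw [← card_nonzero]
      refine Nat.card_eq_of_bijective
        (fun h : H => (⟨h.1.1.mulVec ![1, 0], hne h.1⟩ : {v : Fin 2 → ZMod 7 // v ≠ 0}))
        ⟨?_, ?_⟩
      · intro a b hab
        have hab' : a.1.1.mulVec ![1, 0] = b.1.1.mulVec ![1, 0] := congrArg Subtype.val hab
        have h1 := hs (b.1⁻¹ * a.1) (H.mul_mem (H.inv_mem b.2) a.2) (by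
          rw [mulVec_mul, hab']
          exact mulVec_inv _ _ _ rfl)
        apply Subtype.ext
        exact (inv_mul_eq_one.mp h1).symm
      · rintro ⟨v, hv⟩
        obtain ⟨k, hk, hkv⟩ := htrans ![1, 0] v e1_ne hv
        exact ⟨⟨k, hk⟩, Subtype.ext hkv⟩
    refine ⟨hcard, ?_⟩
    obtain ⟨f, hf, hfH⟩ : ∃ f : SL3 →* SL7, Function.Injective f ∧ f.range ≤ H := by
      obtain ⟨p, hp, hpv⟩ := htrans ![1, 0] ![0, 1] e1_ne (by decide)
      obtain ⟨q, hq, hqv⟩ := htrans ![1, 0] ![0, 2] e1_ne (by decide)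
      obtain ⟨r, hr, hrv⟩ := htrans ![1, 0] ![1, 1] e1_ne (by decide)
      have hg : ∀ i, ∃ h ∈ H, h.1 = gens (p.1 1 1) (q.1 1 1) (r.1 0 1) i := by
        intro i
        fin_cases i
        · refine ⟨p, hp, ?_⟩
          obtain ⟨h0, h1, h2⟩ := shape p _ hpv
          have h3 := aux1 _ _ h2
          rw [Matrix.eta_fin_two p.1, h0, h1, h3]
          rfl
        · refine ⟨q, hq, ?_⟩
          obtain ⟨h0, h1, h2⟩ := shape q _ hqv
          have h3 := aux2 _ _ h2
          rw [Matrix.eta_fin_two q.1, h0, h1, h3]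
          rfl
        · refine ⟨r, hr, ?_⟩
          obtain ⟨h0, h1, h2⟩ := shape r _ hrv
          have h3 := aux3 _ _ h2
          rw [Matrix.eta_fin_two r.1, h0, h1, h3]
          rfl
      have hw := wprod_mem H _ hg
      have hok := cert_ok (p.1 1 1) (q.1 1 1) (r.1 0 1)
      generalize cert (p.1 1 1) (q.1 1 1) (r.1 0 1) = c at hok
      cases c with
      | bad w v =>
        exfalso
        obtain ⟨hv, hfv, hn⟩ := hok
        obtain ⟨h, hh, hhw⟩ := hw w
        rw [← hhw] at hfv hn
        exact hn (congrArg Subtype.val (hfix h hh v hv hfv))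
      | good M M' wA wB =>
        obtain ⟨hM, hA, hB⟩ := hok
        refine ⟨embHom M M' hM, embHom_injective M M' hM, embHom_range_le M M' hM H ?_ ?_⟩
        · obtain ⟨h, hh, hhw⟩ := hw wA
          have : embHom M M' hM gT = h := Subtype.ext (hA.trans hhw.symm)
          rwa [this]
        · obtain ⟨h, hh, hhw⟩ := hw wB
          have : embHom M M' hM gU = h := Subtype.ext (hB.trans hhw.symm)
          rwa [this]
    let e : (f.range.subgroupOf H) ≃* SL3 :=
      (Subgroup.subgroupOfEquivOfLe hfH).trans (MonoidHom.ofInjective hf).symm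
    have hN : Nat.card (f.range.subgroupOf H) = 24 := by
      rw [Nat.card_congr e.toEquiv, card_SL3]
    have hidx : (f.range.subgroupOf H).index = 2 := by
      have := (f.range.subgroupOf H).card_mul_index
      rw [hN, hcard] at this
      omega
    exact ⟨f.range.subgroupOf H, Subgroup.normal_of_index_eq_two hidx, hidx, ⟨e⟩⟩
  · left
    push Not at hs
    obtain ⟨h, hh, hhv, hne⟩ := hs
    have hsh := stab_shape h hhv
    have hb : h.1 0 1 ≠ 0 := by
      intro h0
      apply hne
      apply Subtype.ext
      rw [hsh, h0]
      decide
    rw [eq_top_iff]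
    intro g _
    obtain ⟨k, hk, hkv⟩ := htrans ![1, 0] (g.1.mulVec ![1, 0]) e1_ne (by
      intro h0
      have := mulVec_inv _ _ _ h0
      rw [Matrix.mulVec_zero] at this
      exact e1_ne this.symm)
    have hu := stab_shape (k⁻¹ * g) (by
      rw [mulVec_mul]
      exact mulVec_inv _ _ _ hkv)
    obtain ⟨n, hn⟩ := aux5 (h.1 0 1) ((k⁻¹ * g).1 0 1) hb
    rw [← hsh, ← hu] at hn
    have h1 : h ^ n.1 = k⁻¹ * g := Subtype.ext hn
    have h2 : g = k * h ^ n.1 := by rw [h1]; group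
    rw [h2]
    exact H.mul_mem hk (H.pow_mem hh _)
end

section
/- Let H be a subgroup of SL₂(𝔽₁₁) that acts transitively on the set of nonzero vectors of 𝔽₁₁² (under matrix-vector multiplication). Then either H = SL₂(𝔽₁₁) or H is isomorphic to SL₂(𝔽₅). -/
namespace SL2Eleven

open Matrix

/-- The group `SL₂(𝔽₁₁)`. -/
abbrev G := Matrix.SpecialLinearGroup (Fin 2) (ZMod 11)
/-- The group `SL₂(𝔽₅)`. -/
abbrev K := Matrix.SpecialLinearGroup (Fin 2) (ZMod 5)

instance : Nontrivial (ZMod 11) := ⟨0, 1, by decide⟩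
instance : Nontrivial (ZMod 5) := ⟨0, 1, by decide⟩

lemma inv_four : ∀ d : ZMod 11, 4 * d = 1 → d = 3 := by decide

lemma four_ne : (4 : ZMod 11) ≠ 0 := by decide

/-- 2×2 matrices over `𝔽₁₁` as quadruples. -/
abbrev Q := ZMod 11 × ZMod 11 × ZMod 11 × ZMod 11

def qmul (x y : Q) : Q :=
  (x.1 * y.1 + x.2.1 * y.2.2.1, x.1 * y.2.1 + x.2.1 * y.2.2.2,
   x.2.2.1 * y.1 + x.2.2.2 * y.2.2.1, x.2.2.1 * y.2.1 + x.2.2.2 * y.2.2.2)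

def qone : Q := (1, 0, 0, 1)

def qpow (x : Q) : ℕ → Q
  | 0 => qone
  | n + 1 => qmul (qpow x n) x

def qtr (x : Q) : ZMod 11 := x.1 + x.2.2.2

def qdet (x : Q) : ZMod 11 := x.1 * x.2.2.2 - x.2.1 * x.2.2.1

/-- a quadruple as a matrix -/
def mat (x : Q) : Matrix (Fin 2) (Fin 2) (ZMod 11) := !![x.1, x.2.1; x.2.2.1, x.2.2.2]

/-- not a nontrivial element of trace `±2` -/
def Good (x : Q) : Prop := (qtr x ≠ 2 ∧ qtr x ≠ -2) ∨ (x = qone ∨ x = (-1, 0, 0, -1))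

instance (x : Q) : Decidable (Good x) := by unfold Good; infer_instance

lemma mat_mul (x y : Q) : mat (qmul x y) = mat x * mat y := by
  simp [mat, qmul]

lemma mat_one : mat qone = 1 := by
  simp [mat, qone, Matrix.one_fin_two]

lemma mat_det (x : Q) : (mat x).det = qdet x := by
  simp [mat, qdet, Matrix.det_fin_two]

lemma mat_inj {x y : Q} (h : mat x = mat y) : x = y := by
  obtain ⟨a, b, c, d⟩ := x
  obtain ⟨a', b', c', d'⟩ := y
  have h1 := congrFun (congrFun h 0) 0
  have h2 := congrFun (congrFun h 0) 1
  have h3 := congrFun (congrFun h 1) 0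
  have h4 := congrFun (congrFun h 1) 1
  simp [mat] at h1 h2 h3 h4
  simp [h1, h2, h3, h4]

/-- the matrix `diag(4, 3)` of order five -/
def qD : Q := (4, 0, 0, 3)
def qW : Q := (0, -1, 1, 0)
def qH (b : ZMod 11) : Q := (1, b, 1, 1 + b)
/-- second generator of the image of `SL₂(𝔽₅)` -/
def qL (s : Bool) : Q := if s then (5, 8, 8, 2) else (5, 3, 3, 2)

def word (s : Bool) (i j k l : ℕ) : Q :=
  qmul (qmul (qpow qD i) (qpow (qL s) j)) (qmul (qpow qD k) (qpow (qL s) l))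

def F (s : Bool) (a b c d : ZMod 5) : Q :=
  if c = 0 then word s ((a + b - 1) * d⁻¹).val d.val ((d - 1) * d⁻¹).val 4
  else word s ((a - 1) * c⁻¹).val c.val ((d - 1) * c⁻¹).val 0

set_option maxRecDepth 100000

lemma F_one : ∀ s, F s 1 0 0 1 = qone := by decide +kernel

lemma F_det : ∀ s, ∀ a b c d : ZMod 5, a * d - b * c = 1 → qdet (F s a b c d) = 1 := by
  decide +kernel

set_option synthInstance.maxHeartbeats 400000 in
set_option synthInstance.maxSize 4000 in
lemma F_inj : ∀ s, ∀ a b c d : ZMod 5, a * d - b * c = 1 → F s a b c d = qone →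
    (a, b, c, d) = (1, 0, 0, 1) := by
  decide +kernel

lemma F_u : ∀ s, ∀ a b c d x : ZMod 5, a * d - b * c = 1 →
    F s a (a * x + b) c (c * x + d) = qmul (F s a b c d) (F s 1 x 0 1) := by
  decide +kernel

lemma F_l : ∀ s, ∀ a b c d x : ZMod 5, a * d - b * c = 1 →
    F s (a + b * x) b (c + d * x) d = qmul (F s a b c d) (F s 1 0 x 1) := by
  decide +kernel

/-- for each nonzero vector `(x, y)`, at position `11 x + y`, the element of `SL₂(𝔽₅)` (its entries
read as base-five digits) whose image has first column `(x, y)` -/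
def tab : Bool → List ℕ
  | true => [
    0, 377, 278, 427, 452, 402, 353, 303, 328, 477, 253, 126, 136, 382, 310, 62, 588, 209, 581,
    105, 464, 258, 554, 623, 568, 146, 295, 47, 444, 340, 92, 499, 141, 226, 60, 109, 239, 611,
    387, 431, 183, 332, 263, 605, 151, 362, 230, 411, 163, 64, 557, 309, 458, 560, 106, 176,
    488, 533, 537, 289, 185, 355, 107, 131, 61, 409, 579, 371, 94, 524, 48, 420, 590, 491, 243,
    247, 292, 604, 49, 215, 322, 471, 223, 91, 617, 369, 545, 418, 529, 170, 392, 448, 597, 349,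
    268, 169, 541, 46, 90, 201, 514, 281, 63, 435, 336, 108, 480, 509, 212, 157, 504, 397, 316,
    45, 199, 571, 192, 93, 465, 273, 519]
  | false => [
    0, 253, 477, 328, 303, 353, 402, 452, 427, 278, 377, 126, 258, 464, 105, 581, 209, 588, 62,
    310, 382, 136, 554, 141, 499, 92, 340, 444, 47, 295, 146, 568, 623, 226, 605, 263, 332, 183,
    431, 387, 611, 239, 109, 60, 151, 106, 560, 458, 309, 557, 64, 163, 411, 230, 362, 176, 409,
    61, 131, 107, 355, 185, 289, 537, 533, 488, 579, 292, 247, 243, 491, 590, 420, 48, 524, 94,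
    371, 604, 418, 545, 369, 617, 91, 223, 471, 322, 215, 49, 529, 90, 46, 541, 169, 268, 349,
    597, 448, 392, 170, 201, 157, 212, 509, 480, 108, 336, 435, 63, 281, 514, 504, 519, 273,
    465, 93, 192, 571, 199, 45, 316, 397]

lemma F_tab : ∀ s, ∀ x y : ZMod 11, (x ≠ 0 ∨ y ≠ 0) →
    (fun n : ℕ => (fun a b c d : ZMod 5 =>
      a * d - b * c = 1 ∧ (F s a b c d).1 = x ∧ (F s a b c d).2.2.1 = y)
      ((n / 125 : ℕ) : ZMod 5) ((n / 25 : ℕ) : ZMod 5) ((n / 5 : ℕ) : ZMod 5) (n : ZMod 5))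
      ((tab s).getD (11 * x.val + y.val) 0) := by
  decide +kernel

lemma F_surj (s : Bool) (x y : ZMod 11) (h : x ≠ 0 ∨ y ≠ 0) : ∃ a b c d : ZMod 5,
    a * d - b * c = 1 ∧ (F s a b c d).1 = x ∧ (F s a b c d).2.2.1 = y :=
  ⟨_, _, _, _, F_tab s x y h⟩

lemma det_K (g : K) : g 0 0 * g 1 1 - g 0 1 * g 1 0 = 1 := by
  have := g.det_coe
  rwa [Matrix.det_fin_two] at this

lemma det_G (g : G) : g 0 0 * g 1 1 - g 0 1 * g 1 0 = 1 := by
  have := g.det_coe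
  rwa [Matrix.det_fin_two] at this

/-- the map `SL₂(𝔽₅) → SL₂(𝔽₁₁)` -/
def f0 (s : Bool) (g : K) : G :=
  ⟨mat (F s (g 0 0) (g 0 1) (g 1 0) (g 1 1)), by rw [mat_det]; exact F_det s _ _ _ _ (det_K g)⟩

def uK (x : ZMod 5) : K := ⟨!![1, x; 0, 1], by simp [Matrix.det_fin_two]⟩
def lK (x : ZMod 5) : K := ⟨!![1, 0; x, 1], by simp [Matrix.det_fin_two]⟩

lemma uK_coe (x : ZMod 5) : (uK x : Matrix (Fin 2) (Fin 2) (ZMod 5)) = !![1, x; 0, 1] := rfl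
lemma lK_coe (x : ZMod 5) : (lK x : Matrix (Fin 2) (Fin 2) (ZMod 5)) = !![1, 0; x, 1] := rfl
lemma f0_coe (s : Bool) (g : K) : (f0 s g : Matrix (Fin 2) (Fin 2) (ZMod 11)) =
    mat (F s (g 0 0) (g 0 1) (g 1 0) (g 1 1)) := rfl

lemma f0_u (s : Bool) (g : K) (x : ZMod 5) : f0 s (g * uK x) = f0 s g * f0 s (uK x) := by
  apply Subtype.ext
  have := congrArg mat (F_u s (g 0 0) (g 0 1) (g 1 0) (g 1 1) x (det_K g))
  rw [mat_mul] at this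
  simpa [f0_coe, uK_coe, Matrix.mul_apply, Fin.sum_univ_two] using this

lemma f0_l (s : Bool) (g : K) (x : ZMod 5) : f0 s (g * lK x) = f0 s g * f0 s (lK x) := by
  apply Subtype.ext
  have := congrArg mat (F_l s (g 0 0) (g 0 1) (g 1 0) (g 1 1) x (det_K g))
  rw [mat_mul] at this
  simpa [f0_coe, lK_coe, Matrix.mul_apply, Fin.sum_univ_two] using this

lemma K_decomp (k : K) (hc : k 1 0 ≠ 0) :
    k = uK ((k 0 0 - 1) * (k 1 0)⁻¹) * lK (k 1 0) * uK ((k 1 1 - 1) * (k 1 0)⁻¹) := by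
  have key : ∀ a b c d : ZMod 5, a * d - b * c = 1 → c ≠ 0 →
      a = 1 + (a - 1) * c⁻¹ * c ∧
      b = (1 + (a - 1) * c⁻¹ * c) * ((d - 1) * c⁻¹) + (a - 1) * c⁻¹ ∧
      d = c * ((d - 1) * c⁻¹) + 1 := by decide +kernel
  obtain ⟨h1, h2, h3⟩ := key _ _ _ _ (det_K k) hc
  apply Subtype.ext
  ext i j
  fin_cases i <;> fin_cases j
  · simpa [uK_coe, lK_coe, Matrix.mul_apply, Fin.sum_univ_two] using h1
  · simpa [uK_coe, lK_coe, Matrix.mul_apply, Fin.sum_univ_two] using h2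
  · simp [uK_coe, lK_coe, Matrix.mul_apply, Fin.sum_univ_two]
  · simpa [uK_coe, lK_coe, Matrix.mul_apply, Fin.sum_univ_two] using h3

lemma f0_mul_of (s : Bool) (g k : K) (hc : k 1 0 ≠ 0) : f0 s (g * k) = f0 s g * f0 s k := by
  rw [K_decomp k hc, ← mul_assoc, ← mul_assoc, f0_u, f0_l, f0_u, f0_u, f0_l]
  simp only [mul_assoc]

lemma f0_mul (s : Bool) (g k : K) : f0 s (g * k) = f0 s g * f0 s k := by
  by_cases hc : k 1 0 = 0
  · have h1 : k = (k * lK 1) * lK (-1) := by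
      rw [mul_assoc]
      have : lK 1 * lK (-1) = 1 := by
        apply Subtype.ext
        simp [lK_coe, Matrix.mul_fin_two, Matrix.one_fin_two]
      rw [this, mul_one]
    have h2 : (k * lK 1) 1 0 ≠ 0 := by
      have hd := det_K k
      rw [hc] at hd
      have : (k * lK 1) 1 0 = k 1 1 := by
        simp [lK_coe, Matrix.mul_apply, Fin.sum_univ_two, hc]
      rw [this]
      intro h
      rw [h] at hd
      simp at hd
    rw [h1, ← mul_assoc, f0_l, f0_l, f0_mul_of s g _ h2, mul_assoc]
  · exact f0_mul_of s g k hc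

lemma f0_one (s : Bool) : f0 s 1 = 1 := by
  apply Subtype.ext
  have := congrArg mat (F_one s)
  rw [mat_one] at this
  simpa [f0_coe] using this

def f (s : Bool) : K →* G where
  toFun := f0 s
  map_one' := f0_one s
  map_mul' := f0_mul s

lemma f_inj (s : Bool) : Function.Injective (f s) := by
  rw [injective_iff_map_eq_one]
  intro g hg
  have h1 : mat (F s (g 0 0) (g 0 1) (g 1 0) (g 1 1)) = mat qone := by
    rw [mat_one]
    exact congrArg Subtype.val hg
  have h2 := F_inj s _ _ _ _ (det_K g) (mat_inj h1)
  simp only [Prod.mk.injEq] at h2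
  obtain ⟨ha, hb, hc, hd⟩ := h2
  apply Subtype.ext
  ext i j
  fin_cases i <;> fin_cases j
  · simpa using ha
  · simpa using hb
  · simpa using hc
  · simpa using hd

/-- membership of quadruples in a subgroup -/
def InH (H : Subgroup G) (x : Q) : Prop := ∃ h ∈ H, (h : Matrix (Fin 2) (Fin 2) (ZMod 11)) = mat x

lemma InH.mul {H : Subgroup G} {x y : Q} (hx : InH H x) (hy : InH H y) : InH H (qmul x y) := by
  obtain ⟨g, hg, hgx⟩ := hx
  obtain ⟨k, hk, hky⟩ := hy
  exact ⟨g * k, H.mul_mem hg hk, by rw [mat_mul, ← hgx, ← hky]; rfl⟩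

lemma InH.pow {H : Subgroup G} {x : Q} (hx : InH H x) (n : ℕ) : InH H (qpow x n) := by
  induction n with
  | zero => exact ⟨1, H.one_mem, by rw [qpow, mat_one]; rfl⟩
  | succ n ih => exact ih.mul hx

lemma InH.F {H : Subgroup G} {s : Bool} (hD : InH H qD) (hL : InH H (qL s)) (a b c d : ZMod 5) :
    InH H (F s a b c d) := by
  unfold SL2Eleven.F
  split_ifs
  · exact ((hD.pow _).mul (hL.pow _)).mul ((hD.pow _).mul (hL.pow _))
  · exact ((hD.pow _).mul (hL.pow _)).mul ((hD.pow _).mul (hL.pow _))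

lemma exists_col {H : Subgroup G} (htrans : ∀ u v : Fin 2 → ZMod 11, u ≠ 0 → v ≠ 0 →
      ∃ h ∈ H, Matrix.mulVec (h : Matrix (Fin 2) (Fin 2) (ZMod 11)) u = v)
    (x y : ZMod 11) (hxy : x ≠ 0 ∨ y ≠ 0) : ∃ b d, x * d - b * y = 1 ∧ InH H (x, b, y, d) := by
  obtain ⟨h, hh, he⟩ := htrans ![1, 0] ![x, y]
    (by intro h; simpa using congrFun h 0)
    (by
      intro h
      have h0 := congrFun h 0
      have h1 := congrFun h 1
      simp at h0 h1
      tauto)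
  have h0 := congrFun he 0
  have h1 := congrFun he 1
  simp [Matrix.mulVec, dotProduct, Fin.sum_univ_two] at h0 h1
  refine ⟨h 0 1, h 1 1, ?_, h, hh, ?_⟩
  · rw [← h0, ← h1]; exact det_G h
  · ext i j
    fin_cases i <;> fin_cases j <;> simp [mat, h0, h1]

lemma core (H : Subgroup G) (htrans : ∀ u v : Fin 2 → ZMod 11, u ≠ 0 → v ≠ 0 →
      ∃ h ∈ H, Matrix.mulVec (h : Matrix (Fin 2) (Fin 2) (ZMod 11)) u = v)
    (hfree : ∀ h ∈ H, h 0 0 + h 1 1 = 2 → h = 1) (hD : InH H qD) : Nonempty (H ≃* K) := by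
  have free : ∀ x, InH H x → qtr x = 2 → x = qone := by
    rintro x ⟨h, hh, hx⟩ ht
    have h1 : h = 1 := by
      apply hfree h hh
      rw [hx]
      simpa [mat, qtr] using ht
    apply mat_inj
    rw [← hx, h1, mat_one]
    rfl
  have hneg : InH H (-1, 0, 0, -1) := by
    obtain ⟨b, d, hd, hm⟩ := exists_col htrans (-1) 0 (by decide)
    have hd' : d = -1 := by linear_combination -hd
    subst hd'
    have h2 := free _ (hm.mul hm) (by simp [qmul, qtr]; decide)
    have : ∀ b : ZMod 11, qmul (-1, b, 0, -1) (-1, b, 0, -1) = qone → b = 0 := by decide +kernel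
    rw [this b h2] at hm
    exact hm
  have free2 : ∀ x, InH H x → qtr x = -2 → x = (-1, 0, 0, -1) := by
    intro x hx ht
    have h1 := free _ (hneg.mul hx) (by
      simp only [qmul, qtr] at ht ⊢
      linear_combination -ht)
    obtain ⟨a, b, c, d⟩ := x
    simp [qmul, qone] at h1
    obtain ⟨h1, h2, h3, h4⟩ := h1
    simp only [Prod.mk.injEq]
    refine ⟨?_, h2, h3, ?_⟩
    · linear_combination -h1
    · linear_combination -h4
  have nt : ∀ x, InH H x → Good x := by
    intro x hx
    by_cases h1 : qtr x = 2
    · exact Or.inr (Or.inl (free x hx h1))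
    by_cases h2 : qtr x = -2
    · exact Or.inr (Or.inr (free2 x hx h2))
    exact Or.inl ⟨h1, h2⟩
  have hW : InH H qW := by
    obtain ⟨b, t, hd, hm⟩ := exists_col htrans 0 1 (by decide)
    have hb : b = -1 := by linear_combination -hd
    subst hb
    have key : ∀ t : ZMod 11, (∀ k : Fin 5, Good (qmul (qpow qD k) (0, -1, 1, t))) → t = 0 := by
      decide +kernel
    have ht := key t (fun k => nt _ ((hD.pow k).mul hm))
    rw [ht] at hm
    exact hm
  obtain ⟨b, hB, hb⟩ : ∃ b, (b = 1 ∨ b = 9) ∧ InH H (qH b) := by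
    obtain ⟨b, d, hd, hm⟩ := exists_col htrans 1 1 (by decide)
    have hb : d = 1 + b := by linear_combination hd
    subst hb
    refine ⟨b, ?_, hm⟩
    have key : ∀ b : ZMod 11, (∀ k : Fin 5, Good (qmul (qpow qD k) (qH b))) →
        (∀ k : Fin 5, Good (qmul (qmul (qpow qD k) (qH b)) qW)) →
        Good (qmul (qmul (qH b) (qH b)) (qmul (qpow qD 3) qW)) → b = 1 ∨ b = 9 := by
      decide +kernel
    exact key b (fun k => nt _ ((hD.pow k).mul hm)) (fun k => nt _ (((hD.pow k).mul hm).mul hW))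
      (nt _ ((InH.mul hm hm).mul ((hD.pow 3).mul hW)))
  obtain ⟨s, hL⟩ : ∃ s, InH H (qL s) := by
    rcases hB with rfl | rfl
    · refine ⟨true, ?_⟩
      have h1 : qL true = qmul (qmul (qpow qD 3) (qH 1)) (qmul (qpow qD 1) qW) := by
        decide +kernel
      rw [h1]
      exact ((hD.pow 3).mul hb).mul ((hD.pow 1).mul hW)
    · refine ⟨false, ?_⟩
      have h1 : qL false = qmul (qmul (qpow qD 4) (qH 9)) (qpow qD 3) := by
        decide +kernel
      rw [h1]
      exact ((hD.pow 4).mul hb).mul (hD.pow 3)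
  have hle : ∀ g : K, f s g ∈ H := by
    intro g
    obtain ⟨h, hh, he⟩ := InH.F hD hL (g 0 0) (g 0 1) (g 1 0) (g 1 1)
    have : h = f s g := Subtype.ext he
    rwa [← this]
  have hsurj : ∀ h ∈ H, ∃ g : K, f s g = h := by
    intro h hh
    have hne : h 0 0 ≠ 0 ∨ h 1 0 ≠ 0 := by
      by_contra hcon
      push Not at hcon
      have := det_G h
      rw [hcon.1, hcon.2] at this
      simp at this
    obtain ⟨a, b, c, d, hdet, h0, h1⟩ := F_surj s _ _ hne
    let g : K := ⟨!![a, b; c, d], by rw [Matrix.det_fin_two]; simpa using hdet⟩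
    refine ⟨g, ?_⟩
    have e0 : f s g 0 0 = h 0 0 := by rw [← h0]; rfl
    have e1 : f s g 1 0 = h 1 0 := by rw [← h1]; rfl
    have hmem : h⁻¹ * f s g ∈ H := H.mul_mem (H.inv_mem hh) (hle g)
    have hone := hfree _ hmem (by
      have d1 := det_G h
      have d2 := det_G (f s g)
      rw [e0, e1] at d2
      simp [Matrix.SpecialLinearGroup.coe_mul, Matrix.SpecialLinearGroup.coe_inv,
        Matrix.adjugate_fin_two, Matrix.mul_apply, Fin.sum_univ_two, e0, e1]
      linear_combination d1 + d2)
    exact (inv_mul_eq_one.mp hone).symm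
  let φ : K →* H := (f s).codRestrict H hle
  refine ⟨(MulEquiv.ofBijective φ ⟨?_, ?_⟩).symm⟩
  · intro x y hxy
    exact f_inj s (congrArg Subtype.val hxy)
  · rintro ⟨h, hh⟩
    obtain ⟨g, hg⟩ := hsurj h hh
    exact ⟨g, Subtype.ext hg⟩

/-- upper unipotents -/
def uG (x : ZMod 11) : G := ⟨!![1, x; 0, 1], by simp [Matrix.det_fin_two]⟩

lemma uG_coe (x : ZMod 11) : (uG x : Matrix (Fin 2) (Fin 2) (ZMod 11)) = !![1, x; 0, 1] := rfl

lemma uG_add (x y : ZMod 11) : uG (x + y) = uG x * uG y := by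
  apply Subtype.ext
  simp [uG_coe, Matrix.mul_fin_two, add_comm]

lemma uG_pow (x : ZMod 11) (n : ℕ) : uG x ^ n = uG (n * x) := by
  induction n with
  | zero =>
    apply Subtype.ext
    simp [uG_coe, Matrix.one_fin_two]
  | succ n ih =>
    rw [pow_succ, ih, ← uG_add]
    congr 1
    push_cast
    ring

lemma eq_uG (g : G) (h0 : g 0 0 = 1) (h1 : g 1 0 = 0) : g = uG (g 0 1) := by
  have hd := det_G g
  rw [h0, h1] at hd
  have hd' : g 1 1 = 1 := by linear_combination hd
  apply Subtype.ext
  ext i j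
  fin_cases i <;> fin_cases j
  · simpa [uG_coe] using h0
  · simp [uG_coe]
  · simpa [uG_coe] using h1
  · simpa [uG_coe] using hd'

end SL2Eleven

open SL2Eleven in
/-- a subgroup `H ≤ SL₂(𝔽₁₁)` acting transitively on the nonzero vectors of
`𝔽₁₁²` is either all of `SL₂(𝔽₁₁)` or isomorphic to `SL₂(𝔽₅)`. -/
theorem transitive_subgroup_sl2_eleven
    (H : Subgroup (Matrix.SpecialLinearGroup (Fin 2) (ZMod 11)))
    (htrans : ∀ u v : Fin 2 → ZMod 11, u ≠ 0 → v ≠ 0 →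
      ∃ h ∈ H, Matrix.mulVec (h : Matrix (Fin 2) (Fin 2) (ZMod 11)) u = v) :
    H = ⊤ ∨ Nonempty (H ≃* Matrix.SpecialLinearGroup (Fin 2) (ZMod 5)) := by
  have : Fact (Nat.Prime 11) := ⟨by norm_num⟩
  have he1 : (![1, 0] : Fin 2 → ZMod 11) ≠ 0 := by
    intro h
    simpa using congrFun h 0
  by_cases hu : ∃ x : ZMod 11, x ≠ 0 ∧ uG x ∈ H
  · left
    obtain ⟨x, hx, hxH⟩ := hu
    have hall : ∀ y, uG y ∈ H := by
      intro y
      have := H.pow_mem hxH (y * x⁻¹).val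
      rw [uG_pow, ZMod.natCast_zmod_val, inv_mul_cancel_right₀ hx] at this
      exact this
    rw [eq_top_iff]
    intro g _
    have hgne : Matrix.mulVec (g : Matrix (Fin 2) (Fin 2) (ZMod 11)) ![1, 0] ≠ 0 := by
      intro h
      have h0 := congrFun h 0
      have h1 := congrFun h 1
      simp [Matrix.mulVec, dotProduct, Fin.sum_univ_two] at h0 h1
      have := det_G g
      rw [h0, h1] at this
      simp at this
    obtain ⟨h, hh, he⟩ := htrans ![1, 0] _ he1 hgne
    have hfix : Matrix.mulVec ((h⁻¹ * g : G) : Matrix (Fin 2) (Fin 2) (ZMod 11)) ![1, 0]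
        = ![1, 0] := by
      rw [Matrix.SpecialLinearGroup.coe_mul, ← Matrix.mulVec_mulVec, ← he, Matrix.mulVec_mulVec,
        ← Matrix.SpecialLinearGroup.coe_mul]
      simp
    have h0 := congrFun hfix 0
    have h1 := congrFun hfix 1
    simp only [Matrix.mulVec, dotProduct, Fin.sum_univ_two] at h0 h1
    have h2 : h⁻¹ * g ∈ H := by
      rw [eq_uG (h⁻¹ * g) (by simpa using h0) (by simpa using h1)]
      exact hall _
    have := H.mul_mem hh h2
    rwa [mul_inv_cancel_left] at this
  · right
    push Not at hu
    -- elements of trace two are trivial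
    have hfree : ∀ h ∈ H, h 0 0 + h 1 1 = 2 → h = 1 := by
      intro h hh ht
      have hdet : ((h : Matrix (Fin 2) (Fin 2) (ZMod 11)) - 1).det = 0 := by
        rw [Matrix.det_fin_two]
        have := det_G h
        simp
        linear_combination this - ht
      obtain ⟨v, hv, hv0⟩ := Matrix.exists_mulVec_eq_zero_iff.mpr hdet
      rw [Matrix.sub_mulVec, Matrix.one_mulVec, sub_eq_zero] at hv0
      obtain ⟨k, hk, hkv⟩ := htrans _ v he1 hv
      have hfix : Matrix.mulVec ((k⁻¹ * (h * k) : G) : Matrix (Fin 2) (Fin 2) (ZMod 11)) ![1, 0]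
          = ![1, 0] := by
        rw [Matrix.SpecialLinearGroup.coe_mul, Matrix.SpecialLinearGroup.coe_mul,
          ← Matrix.mulVec_mulVec, ← Matrix.mulVec_mulVec, hkv, hv0, ← hkv, Matrix.mulVec_mulVec,
          ← Matrix.SpecialLinearGroup.coe_mul]
        simp
      have h0 := congrFun hfix 0
      have h1 := congrFun hfix 1
      simp only [Matrix.mulVec, dotProduct, Fin.sum_univ_two] at h0 h1
      have h2 := eq_uG (k⁻¹ * (h * k)) (by simpa using h0) (by simpa using h1)
      have h3 : k⁻¹ * (h * k) ∈ H := H.mul_mem (H.inv_mem hk) (H.mul_mem hh hk)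
      have h4 : (k⁻¹ * (h * k)) 0 1 = 0 := by
        by_contra hne
        rw [h2] at h3
        exact hu _ hne h3
      rw [h4] at h2
      have h5 : uG 0 = 1 := by simpa using (uG_pow 0 0).symm
      rw [h5, inv_mul_eq_one] at h2
      exact (mul_eq_right.mp h2.symm)
    -- conjugate so that `diag(4, 3)` is in the subgroup
    obtain ⟨b, d, hd, h, hh, hm⟩ := exists_col htrans 4 0 (Or.inl four_ne)
    have hd' : d = 3 := by
      apply inv_four
      linear_combination hd
    subst hd'
    let e : G ≃* G := MulAut.conj (uG b)
    have hcore : Nonempty ((H.map e.toMonoidHom) ≃* K) := by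
      apply core
      · intro u v hu0 hv0
        have hne : ∀ (g : G) (w : Fin 2 → ZMod 11), w ≠ 0 →
            Matrix.mulVec (g : Matrix (Fin 2) (Fin 2) (ZMod 11)) w ≠ 0 := by
          intro g w hw hz
          apply hw
          have := congrArg (Matrix.mulVec ((g⁻¹ : G) : Matrix (Fin 2) (Fin 2) (ZMod 11))) hz
          rw [Matrix.mulVec_mulVec, ← Matrix.SpecialLinearGroup.coe_mul] at this
          simpa using this
        obtain ⟨k, hk, hkv⟩ := htrans _ _ (hne (uG b)⁻¹ u hu0) (hne (uG b)⁻¹ v hv0)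
        refine ⟨e k, ⟨k, hk, rfl⟩, ?_⟩
        have : e k = uG b * (k * (uG b)⁻¹) := by simp [e, MulAut.conj_apply, mul_assoc]
        rw [this, Matrix.SpecialLinearGroup.coe_mul, Matrix.SpecialLinearGroup.coe_mul,
          ← Matrix.mulVec_mulVec, ← Matrix.mulVec_mulVec, hkv, Matrix.mulVec_mulVec,
          ← Matrix.SpecialLinearGroup.coe_mul]
        simp
      · rintro _ ⟨k, hk, rfl⟩ ht
        have h1 : k = 1 := by
          apply hfree k hk
          rw [← ht]
          have hek : e.toMonoidHom k = uG b * (k * (uG b)⁻¹) := by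
            simp [e, MulAut.conj_apply, mul_assoc]
          rw [hek]
          simp [uG_coe, Matrix.adjugate_fin_two, Matrix.mul_apply,
            Fin.sum_univ_two]
          try ring
        rw [h1, map_one]
      · refine ⟨e h, ⟨h, hh, rfl⟩, ?_⟩
        have : e h = uG b * (h * (uG b)⁻¹) := by simp [e, MulAut.conj_apply, mul_assoc]
        rw [this, Matrix.SpecialLinearGroup.coe_mul, Matrix.SpecialLinearGroup.coe_mul, hm]
        simp [mat, qD, uG_coe, Matrix.SpecialLinearGroup.coe_inv, Matrix.adjugate_fin_two, Matrix.mul_fin_two]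
        try ring
    obtain ⟨i⟩ := hcore
    exact ⟨(H.equivMapOfInjective e.toMonoidHom e.injective).trans i⟩
end
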